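/- arXiv:1301.4897 — 3 statements merged into one kernel-verified Lean document; each statement's English description precedes it below -/
import Mathlib

section
/- Lebesgue measure on G = ℝ × ℝ^{2d} × ℝ is a left Haar measure for the group law: for every g ∈ G, the left translation map x ↦ g·x is measure preserving for the product Lebesgue measure (equivalently, the pushforward of Lebesgue measure under x ↦ g·x equals Lebesgue measure). -/
open MeasureTheory

/-- The standard symplectic form `ω₀` on `ℝ^{2d}`. -/
def omega0 (d : ℕ) (v v' : Fin (2 * d) → ℝ) : ℝ :=
  ∑ i : Fin d,
    (v ⟨(i : ℕ), by omega⟩ * v' ⟨(i : ℕ) + d, by omega⟩ -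
      v ⟨(i : ℕ) + d, by omega⟩ * v' ⟨(i : ℕ), by omega⟩)

/-- The group operation on `G = ℝ × ℝ^{2d} × ℝ`:
`(a,v,t)·(a',v',t') = (a+a', e^{−a'}v + v', e^{−2a'}t + t' + (1/2)e^{−a'}ω₀(v,v'))`. -/
noncomputable def gmul (d : ℕ) (x y : ℝ × (Fin (2 * d) → ℝ) × ℝ) :
    ℝ × (Fin (2 * d) → ℝ) × ℝ :=
  (x.1 + y.1,
    fun i => Real.exp (-y.1) * x.2.1 i + y.2.1 i,
    Real.exp (-2 * y.1) * x.2.2 + y.2.2 + (1 / 2) * Real.exp (-y.1) * omega0 d x.2.1 y.2.1)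

/-- Translating the first factor by `w` while shearing the second one by a measurable function
of the first preserves Lebesgue measure. -/
theorem measurePreserving_translate_shear {ι : Type*} [Fintype ι] (w : ι → ℝ)
    {f : (ι → ℝ) → ℝ} (hf : Measurable f) :
    MeasurePreserving (fun p : (ι → ℝ) × ℝ => (w + p.1, f p.1 + p.2)) volume volume :=
  (measurePreserving_add_left volume w).skew_product (g := fun v t => f v + t)
    ((hf.comp measurable_fst).add measurable_snd)
    (Filter.Eventually.of_forall fun v => (measurePreserving_add_left volume (f v)).map_eq)

theorem continuous_omega0_right (d : ℕ) (v : Fin (2 * d) → ℝ) :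
    Continuous (omega0 d v) := by
  unfold omega0
  fun_prop

/-- Lebesgue measure (the product of the Lebesgue measures of the three factors) on
`G = ℝ × ℝ^{2d} × ℝ` is a left Haar measure: every left translation `x ↦ g·x` is
measure preserving. -/
theorem stmt_1 (d : ℕ) (g : ℝ × (Fin (2 * d) → ℝ) × ℝ) :
    MeasurePreserving (fun x : ℝ × (Fin (2 * d) → ℝ) × ℝ => gmul d g x)
      volume volume := by
  have homega := continuous_omega0_right d g.2.1
  refine (measurePreserving_add_left volume g.1).skew_product
    (g := fun a p => (gmul d g (a, p)).2) ?_ (Filter.Eventually.of_forall fun a => ?_)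
  · refine Continuous.measurable ?_
    unfold Function.uncurry gmul
    fun_prop
  · have hf : Continuous fun v => Real.exp (-2 * a) * g.2.2 +
        (1 / 2) * Real.exp (-a) * omega0 d g.2.1 v := by fun_prop
    have hshear : (fun p => (gmul d g (a, p)).2) = fun p =>
        ((fun i => Real.exp (-a) * g.2.1 i) + p.1,
          Real.exp (-2 * a) * g.2.2 + (1 / 2) * Real.exp (-a) * omega0 d g.2.1 p.1 + p.2) :=
      funext fun p => Prod.ext rfl (by simp only [gmul]; ring)
    rw [hshear]
    exact (measurePreserving_translate_shear _ hf.measurable).map_eq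
end

section
/- The modular function of G is Δ_G(a,v,t) = e^{−(2d+2)a}: for every h = (a',v',t') ∈ G, the pushforward of Lebesgue measure on G under the right translation map x ↦ x·h equals e^{(2d+2)a'} times Lebesgue measure. -/
open MeasureTheory

/-- The standard symplectic form is measurable in its first argument. -/
theorem measurable_omega0_left (d : ℕ) (w : Fin (2 * d) → ℝ) :
    Measurable fun v => omega0 d v w := by
  unfold omega0
  fun_prop

/-- A dilation by `exp s` followed by a translation divides Haar measure by `exp (s * dim E)`. -/
theorem measurePreserving_exp_smul_add {E : Type*} [NormedAddCommGroup E] [NormedSpace ℝ E]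
    [MeasurableSpace E] [BorelSpace E] [FiniteDimensional ℝ E] (μ : Measure E)
    [μ.IsAddHaarMeasure] (s : ℝ) (b : E) :
    MeasurePreserving (fun x => Real.exp s • x + b) μ
      (ENNReal.ofReal (Real.exp (-(Module.finrank ℝ E * s))) • μ) := by
  refine MeasurePreserving.comp
    (μb := ENNReal.ofReal (Real.exp (-(Module.finrank ℝ E * s))) • μ)
    ((measurePreserving_add_right μ b).smul_measure _) ⟨measurable_const_smul _, ?_⟩
  rw [Measure.map_addHaar_smul μ (Real.exp_ne_zero s), ← Real.exp_nat_mul, ← Real.exp_neg,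
    abs_of_pos (Real.exp_pos _)]

/-- The modular function of `G` is `Δ_G(a,v,t) = e^{−(2d+2)a}`: the pushforward of
Lebesgue measure under the right translation `x ↦ x·h`, `h = (a',v',t')`, equals
`e^{(2d+2)a'}` times Lebesgue measure. -/
theorem stmt_2 (d : ℕ) (h : ℝ × (Fin (2 * d) → ℝ) × ℝ) :
    Measure.map (fun x : ℝ × (Fin (2 * d) → ℝ) × ℝ => gmul d x h) volume =
      ENNReal.ofReal (Real.exp ((2 * (d : ℝ) + 2) * h.1)) • volume := by
  have hv := measurePreserving_exp_smul_add (volume : Measure (Fin (2 * d) → ℝ)) (-h.1) h.2.1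
  have hω := measurable_omega0_left d h.2.1
  have hvt := hv.skew_product (μc := (volume : Measure ℝ))
    (g := fun v t => Real.exp (-2 * h.1) • t +
      (h.2.2 + (1 / 2) * Real.exp (-h.1) * omega0 d v h.2.1))
    (by simp only [Function.uncurry_def]; fun_prop)
    (.of_forall fun v => (measurePreserving_exp_smul_add volume (-2 * h.1) _).map_eq)
  have key := (measurePreserving_add_right (volume : Measure ℝ) h.1).prod hvt
  have hmap : (fun x : ℝ × (Fin (2 * d) → ℝ) × ℝ => gmul d x h) =
      Prod.map (fun a => a + h.1) (fun p : (Fin (2 * d) → ℝ) × ℝ =>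
        (Real.exp (-h.1) • p.1 + h.2.1, Real.exp (-2 * h.1) • p.2 +
          (h.2.2 + (1 / 2) * Real.exp (-h.1) * omega0 d p.1 h.2.1))) := by
    funext x
    simp only [gmul, Prod.map, smul_eq_mul, add_assoc]
    rfl
  rw [hmap, Measure.volume_eq_prod, Measure.volume_eq_prod, key.map_eq, Measure.prod_smul_left,
    Measure.prod_smul_right, Measure.prod_smul_right, Measure.prod_smul_right, smul_smul,
    ← ENNReal.ofReal_mul (Real.exp_nonneg _), ← Real.exp_add]
  congr 3
  simp
  ring
end

section
/- For all x, y ∈ G one has S(y⁻¹·x, y⁻¹) = −S(x, y), where y⁻¹ and y⁻¹·x are computed with the group law of G. -/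
/-- The inverse `(a,v,t)⁻¹ = (−a, −e^{a}v, −e^{2a}t)` in `G`. -/
noncomputable def ginv (d : ℕ) (x : ℝ × (Fin (2 * d) → ℝ) × ℝ) :
    ℝ × (Fin (2 * d) → ℝ) × ℝ :=
  (-x.1, fun i => -(Real.exp x.1 * x.2.1 i), -(Real.exp (2 * x.1) * x.2.2))

/-- `S((a,v,t),(a',v',t')) = sinh(2a)·t' − sinh(2a')·t + cosh(a)·cosh(a')·ω₀(v,v')`. -/
noncomputable def Sfun (d : ℕ) (x y : ℝ × (Fin (2 * d) → ℝ) × ℝ) : ℝ :=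
  Real.sinh (2 * x.1) * y.2.2 - Real.sinh (2 * y.1) * x.2.2 +
    Real.cosh x.1 * Real.cosh y.1 * omega0 d x.2.1 y.2.1

theorem omega0_neg_smul_add_neg_smul (d : ℕ) (p q : ℝ) (v w : Fin (2 * d) → ℝ) :
    omega0 d (fun i => p * -(q * w i) + v i) (fun i => -(q * w i)) = -q * omega0 d v w := by
  simp only [omega0, Finset.mul_sum]
  exact Finset.sum_congr rfl fun i _ => by ring

theorem omega0_neg_smul_left (d : ℕ) (q : ℝ) (v w : Fin (2 * d) → ℝ) :
    omega0 d (fun i => -(q * w i)) v = q * omega0 d v w := by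
  simp only [omega0, Finset.mul_sum]
  exact Finset.sum_congr rfl fun i _ => by ring

/-- For all `x, y ∈ G` one has `S(y⁻¹·x, y⁻¹) = −S(x, y)`. -/
theorem stmt_4 (d : ℕ) (x y : ℝ × (Fin (2 * d) → ℝ) × ℝ) :
    Sfun d (gmul d (ginv d y) x) (ginv d y) = -Sfun d x y := by
  obtain ⟨a, v, t⟩ := x
  obtain ⟨b, w, s⟩ := y
  simp only [Sfun, gmul, ginv, omega0_neg_smul_add_neg_smul, omega0_neg_smul_left]
  have hexp_two_mul (r : ℝ) : Real.exp (2 * r) = Real.exp r ^ 2 := by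
    rw [two_mul, Real.exp_add, sq]
  simp only [Real.sinh_eq, Real.cosh_eq, neg_mul, mul_neg, Real.exp_neg, hexp_two_mul,
    Real.exp_add]
  field_simp
  ring
end
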